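/- Let w ∈ W^P. Then ℓ(w) = height(ω_P^∨ − w(ω_P^∨)), i.e. the length of w equals the sum of the coefficients of ω_P^∨ − w(ω_P^∨) when written in the basis of simple coroots. -/

import Mathlib

open scoped RealInnerProductSpace
open Classical

noncomputable section

variable (V : Type) [NormedAddCommGroup V] [InnerProductSpace ℝ V]

/-- The reflection determined by a vector `α` (the identity map if `α = 0`),
as a linear endomorphism:  `x ↦ x - (2⟪x,α⟫/⟪α,α⟫) • α`. -/
def reflMap (α : V) : V →ₗ[ℝ] V where
  toFun x := x - (2 * ⟪x, α⟫ / ⟪α, α⟫) • α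
  map_add' x y := by
    simp only [inner_add_left]
    rw [show 2 * (⟪x, α⟫ + ⟪y, α⟫) / ⟪α, α⟫
        = 2 * ⟪x, α⟫ / ⟪α, α⟫ + 2 * ⟪y, α⟫ / ⟪α, α⟫ by ring, add_smul]
    abel
  map_smul' c x := by
    simp only [real_inner_smul_left, RingHom.id_apply, smul_sub]
    rw [show 2 * (c * ⟪x, α⟫) / ⟪α, α⟫ = c * (2 * ⟪x, α⟫ / ⟪α, α⟫) by ring,
      mul_smul]

lemma reflMap_apply (α x : V) :
    reflMap V α x = x - (2 * ⟪x, α⟫ / ⟪α, α⟫) • α := rfl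

lemma reflMap_involutive (α : V) : ∀ x, reflMap V α (reflMap V α x) = x := by
  intro x
  by_cases h : (⟪α, α⟫ : ℝ) = 0
  · have h0 : α = 0 := inner_self_eq_zero.mp h
    simp [reflMap_apply, h0]
  · rw [reflMap_apply, reflMap_apply, inner_sub_left, real_inner_smul_left,
      div_mul_cancel₀ _ h]
    rw [show ⟪x, α⟫ - 2 * ⟪x, α⟫ = -⟪x, α⟫ by ring]
    rw [show 2 * -⟪x, α⟫ / ⟪α, α⟫ = -(2 * ⟪x, α⟫ / ⟪α, α⟫) by ring, neg_smul]
    abel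

/-- The reflection determined by a vector `α`, as a linear automorphism of `V`. -/
def sref (α : V) : V ≃ₗ[ℝ] V :=
  { reflMap V α with
    invFun := reflMap V α
    left_inv := reflMap_involutive V α
    right_inv := reflMap_involutive V α }

lemma sref_apply (α x : V) :
    sref V α x = x - (2 * ⟪x, α⟫ / ⟪α, α⟫) • α := rfl

variable {V}

/-- The coroot `α^∨ = 2α/⟪α,α⟫` associated with a root `α`, under the identification of the
coweight space with `V` given by the inner product. -/
def coroot (α : V) : V := (2 / ⟪α, α⟫) • α

/-- The dimension of the `(-1)`-eigenspace of a linear automorphism. -/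
def lamEig (σ : V ≃ₗ[ℝ] V) : ℕ :=
  Module.finrank ℝ (Module.End.eigenspace (σ : V →ₗ[ℝ] V) (-1))

/-- The action `s_α ∘ σ` of a simple reflection on an involution: `s_α σ` if `s_α` and `σ`
commute, and `s_α σ s_α` otherwise. -/
def circAct (α : V) (σ : V ≃ₗ[ℝ] V) : V ≃ₗ[ℝ] V :=
  if sref V α * σ = σ * sref V α then sref V α * σ else sref V α * σ * sref V α

/-- A set of pairwise orthogonal vectors. -/
def OrthSet (S : Finset V) : Prop :=
  (↑S : Set V).Pairwise fun a b => ⟪a, b⟫ = 0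

/-- The product `σ_S` of the (commuting) reflections in the elements of an orthogonal set
`S`. -/
def sigmaOf (S : Finset V) : V ≃ₗ[ℝ] V :=
  (S.toList.map (sref V)).prod

variable (V)

/-- A finite crystallographic reduced root system in the Euclidean space `V`,
together with a fixed choice of simple roots. -/
structure RSD where
  /-- The set of roots. -/
  Φ : Finset V
  /-- The set of simple roots. -/
  Δ : Finset V
  nonzero : (0 : V) ∉ Φ
  span_top : Submodule.span ℝ (Φ : Set V) = ⊤
  reduced : ∀ α ∈ Φ, ∀ c : ℝ, c • α ∈ Φ → c = 1 ∨ c = -1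
  crystal : ∀ α ∈ Φ, ∀ β ∈ Φ, ∃ n : ℤ, (n : ℝ) = 2 * ⟪β, α⟫ / ⟪α, α⟫
  reflClosed : ∀ α ∈ Φ, ∀ β ∈ Φ, sref V α β ∈ Φ
  Δ_sub : Δ ⊆ Φ
  Δ_indep : LinearIndependent ℝ (fun x : (Δ : Set V) => (x : V))
  Δ_base : ∀ α ∈ Φ, (∃ c : V → ℕ, α = ∑ γ ∈ Δ, (c γ : ℝ) • γ) ∨
      (∃ c : V → ℕ, -α = ∑ γ ∈ Δ, (c γ : ℝ) • γ)

namespace RSD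

variable {V}
variable (D : RSD V)

/-- The set of positive roots. -/
def Pos : Set V :=
  {α | α ∈ D.Φ ∧ ∃ c : V → ℕ, α = ∑ γ ∈ D.Δ, (c γ : ℝ) • γ}

/-- The set of negative roots. -/
def Neg : Set V := {α | -α ∈ D.Pos}

/-- The Weyl group, as the subgroup of `GL(V)` generated by the simple reflections. -/
def W : Subgroup (V ≃ₗ[ℝ] V) := Subgroup.closure ((fun γ => sref V γ) '' ↑D.Δ)

/-- The length of `w`: the least number of simple reflections needed to write `w` as a
product of simple reflections. -/
def length (w : V ≃ₗ[ℝ] V) : ℕ :=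
  sInf {n | ∃ l : List V, l.length = n ∧ (∀ γ ∈ l, γ ∈ D.Δ) ∧ w = (l.map (sref V)).prod}

/-- The Bruhat order on the Weyl group: `u ≤ v` iff `v` is obtained from `u` by successively
multiplying by reflections, each time increasing the length. -/
def ble (u v : V ≃ₗ[ℝ] V) : Prop :=
  Relation.ReflTransGen
    (fun x y => (∃ β ∈ D.Φ, y = sref V β * x) ∧ D.length x < D.length y) u v

/-- The strict Bruhat order. -/
def blt (u v : V ≃ₗ[ℝ] V) : Prop := D.ble u v ∧ u ≠ v

/-- The dominance order: `y - x` is a nonnegative integer combination of simple roots. -/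
def dom (x y : V) : Prop := ∃ c : V → ℕ, y - x = ∑ γ ∈ D.Δ, (c γ : ℝ) • γ

/-- The dominance order on coweights: `y - x` is a nonnegative integer combination of simple
coroots. -/
def cdom (x y : V) : Prop := ∃ c : V → ℕ, y - x = ∑ γ ∈ D.Δ, (c γ : ℝ) • coroot γ

/-- The length `L(σ) = (ℓ(σ) + λ(σ))/2` of an involution `σ`, where `λ(σ)` is the dimension
of the `(-1)`-eigenspace of `σ`. -/
def Linv (σ : V ≃ₗ[ℝ] V) : ℚ :=
  ((D.length σ : ℚ) + (lamEig σ : ℚ)) / 2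

end RSD

/-- A finite irreducible crystallographic reduced root system, with a fixed choice of simple
roots and a marked simple root `αP` whose coefficient in the highest root `θ` equals `1`
(the cominuscule case). -/
structure MRSD extends RSD V where
  irred : ¬ ∃ A B : Set V, A.Nonempty ∧ B.Nonempty ∧ A ∪ B = ↑Φ ∧
      ∀ α ∈ A, ∀ β ∈ B, ⟪α, β⟫ = 0
  /-- The marked simple root. -/
  αP : V
  αP_mem : αP ∈ Δ
  /-- The highest root. -/
  θ : V
  θ_mem : θ ∈ Φ
  θ_high : ∀ α ∈ Φ, ∃ c : V → ℕ, θ - α = ∑ γ ∈ Δ, (c γ : ℝ) • γ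
  θ_coeff : ∃ c : V → ℕ, (θ = ∑ γ ∈ Δ, (c γ : ℝ) • γ) ∧ c αP = 1

namespace MRSD

variable {V}
variable (M : MRSD V)

/-- The set `Ψ` of positive roots in which the marked simple root `αP` has coefficient `1`. -/
def Psi : Set V :=
  {α | α ∈ M.Φ ∧ ∃ c : V → ℕ, (α = ∑ γ ∈ M.Δ, (c γ : ℝ) • γ) ∧ c M.αP = 1}

/-- The set of positive roots of the subsystem `Φ_P`, i.e. the positive roots in which the
marked simple root `αP` has coefficient `0`. -/
def PosP : Set V :=
  {α | α ∈ M.Φ ∧ ∃ c : V → ℕ, (α = ∑ γ ∈ M.Δ, (c γ : ℝ) • γ) ∧ c M.αP = 0}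

/-- The parabolic subgroup `W_P` generated by the simple reflections in `Δ ∖ {αP}`. -/
def WP : Subgroup (V ≃ₗ[ℝ] V) :=
  Subgroup.closure ((fun γ => sref V γ) '' ↑(M.Δ.erase M.αP))

/-- The inversion set `Φ⁺(v) = {α ∈ Φ⁺ : v(α) ∈ Φ⁻}`. -/
def InvSet (v : V ≃ₗ[ℝ] V) : Set V := {α | α ∈ M.Pos ∧ v α ∈ M.Neg}

/-- `v` belongs to `W^P`: it lies in `W` and has minimal length in its coset `v W_P`. -/
def IsMinRep (v : V ≃ₗ[ℝ] V) : Prop :=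
  v ∈ M.W ∧ ∀ u, u ∈ M.W → v⁻¹ * u ∈ M.WP → M.length v ≤ M.length u

/-- `μ` is the minimal length representative `[w]^P` of the coset `w W_P`. -/
def IsMinRepOf (μ w : V ≃ₗ[ℝ] V) : Prop :=
  (μ ∈ M.W ∧ w⁻¹ * μ ∈ M.WP) ∧
    ∀ u, u ∈ M.W → w⁻¹ * u ∈ M.WP → M.length μ ≤ M.length u

/-- The subset `Φ_S = {α ∈ Φ : σ_S(α) = -α}` determined by an orthogonal set of roots `S`. -/
def PhiSet (S : Finset V) : Set V := {α | α ∈ M.Φ ∧ sigmaOf S α = -α}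

/-- A root is long if its squared length is maximal among the roots. -/
def IsLong (α : V) : Prop := ∀ β ∈ M.Φ, ⟪β, β⟫ ≤ ⟪α, α⟫

/-- Admissible pair: `v ∈ W^P`, `S ⊆ Ψ` a set of pairwise orthogonal roots with
`v(S) ⊆ Φ⁻`. -/
def Admissible (v : V ≃ₗ[ℝ] V) (S : Finset V) : Prop :=
  M.IsMinRep v ∧ (↑S : Set V) ⊆ M.Psi ∧ OrthSet S ∧ ∀ β ∈ S, v β ∈ M.Neg

/-- The length `L(v,S) = (ℓ(σ_{v(S)}) + |S|)/2` of an admissible pair `(v,S)`. -/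
def pairL (v : V ≃ₗ[ℝ] V) (S : Finset V) : ℚ :=
  ((M.length (sigmaOf (S.image fun x => v x)) : ℚ) + (S.card : ℚ)) / 2

end MRSD

section Reflections

variable {V : Type} [NormedAddCommGroup V] [InnerProductSpace ℝ V]

lemma inner_sref_comm (α x y : V) : ⟪sref V α x, y⟫ = ⟪x, sref V α y⟫ := by
  simp only [sref_apply, inner_sub_left, inner_sub_right, real_inner_smul_right,
    real_inner_comm]
  ring

lemma sref_sref (α x : V) : sref V α (sref V α x) = x := reflMap_involutive V α x

lemma sref_mul_self (α : V) : sref V α * sref V α = 1 :=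
  LinearEquiv.ext (sref_sref α)

lemma sref_inv (α : V) : (sref V α)⁻¹ = sref V α :=
  inv_eq_of_mul_eq_one_left (sref_mul_self α)

lemma sref_self (α : V) : sref V α α = -α := by
  by_cases h : α = 0
  · simp [sref_apply, h]
  · have h' : (⟪α, α⟫ : ℝ) ≠ 0 := inner_self_ne_zero.mpr h
    rw [sref_apply, mul_div_assoc, div_self h', mul_one, two_smul]
    abel

lemma sref_apply_coroot (α x : V) : sref V α x = x - (⟪x, α⟫ : ℝ) • coroot α := by
  rw [sref_apply, coroot, smul_smul]
  congr 2
  ring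

lemma inv_prod_sref (l : List V) :
    ((l.map (sref V)).prod)⁻¹ = (l.reverse.map (sref V)).prod := by
  induction l with
  | nil => simp
  | cons γ t ih => simp [ih, sref_inv]

lemma inner_prod_sref (l : List V) (x y : V) :
    ⟪(l.map (sref V)).prod x, y⟫ = ⟪x, ((l.map (sref V)).prod)⁻¹ y⟫ := by
  induction l generalizing y with
  | nil => simp
  | cons γ t ih =>
    simp only [List.map_cons, List.prod_cons, mul_inv_rev, LinearEquiv.mul_apply, sref_inv]
    rw [inner_sref_comm, ih]

lemma inner_prod_sref_prod_sref (l : List V) (x y : V) :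
    ⟪(l.map (sref V)).prod x, (l.map (sref V)).prod y⟫ = ⟪x, y⟫ := by
  rw [inner_prod_sref, ← LinearEquiv.mul_apply, inv_mul_cancel, LinearEquiv.coe_one, id]

lemma prod_sref_mul_sref (l : List V) (α : V) :
    (l.map (sref V)).prod * sref V α
      = sref V ((l.map (sref V)).prod α) * (l.map (sref V)).prod := by
  ext x
  simp only [LinearEquiv.mul_apply, sref_apply, inner_prod_sref_prod_sref, map_sub, map_smul]

end Reflections

namespace RSD

variable {V : Type} [NormedAddCommGroup V] [InnerProductSpace ℝ V] (D : RSD V)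

lemma sum_smul_injOn {a b : V → ℝ} (h : ∑ γ ∈ D.Δ, a γ • γ = ∑ γ ∈ D.Δ, b γ • γ) :
    ∀ γ ∈ D.Δ, a γ = b γ := by
  have hli : LinearIndepOn ℝ id (D.Δ : Set V) := D.Δ_indep
  exact linearIndepOn_finset_iffₛ.mp hli a b h

/-- A linear functional taking the value `1` on every simple root. -/
lemma exists_height : ∃ h : V →ₗ[ℝ] ℝ, ∀ γ ∈ D.Δ, h γ = 1 := by
  have hli : LinearIndepOn ℝ id (D.Δ : Set V) := D.Δ_indep
  let B := Module.Basis.extend hli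
  refine ⟨B.constr ℝ fun _ => (1 : ℝ), fun γ hγ => ?_⟩
  have hmem : γ ∈ hli.extend (Set.subset_univ _) := hli.subset_extend _ hγ
  have := B.constr_basis ℝ (fun _ => (1 : ℝ)) ⟨γ, hmem⟩
  rwa [Module.Basis.extend_apply_self] at this

variable {D}

lemma neg_mem {α : V} (hα : α ∈ D.Φ) : -α ∈ D.Φ := by
  simpa [sref_self] using D.reflClosed α hα α hα

lemma pos_or_neg {α : V} (hα : α ∈ D.Φ) : α ∈ D.Pos ∨ α ∈ D.Neg :=
  (D.Δ_base α hα).imp (fun h => ⟨hα, h⟩) (fun h => ⟨neg_mem hα, h⟩)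

lemma height_pos {h : V →ₗ[ℝ] ℝ} (hh : ∀ γ ∈ D.Δ, h γ = 1) {α : V} (hα : α ∈ D.Pos) :
    0 < h α := by
  obtain ⟨hΦ, c, hc⟩ := hα
  have hval : h α = ∑ γ ∈ D.Δ, (c γ : ℝ) := by
    rw [hc, map_sum]
    exact Finset.sum_congr rfl fun γ hγ => by simp [hh γ hγ]
  rw [hval]
  refine lt_of_le_of_ne (Finset.sum_nonneg fun _ _ => Nat.cast_nonneg _) fun h0 => ?_
  have hz := (Finset.sum_eq_zero_iff_of_nonneg fun _ _ => Nat.cast_nonneg _).mp h0.symm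
  apply D.nonzero
  rwa [hc, Finset.sum_eq_zero fun γ hγ => by rw [hz γ hγ, zero_smul]] at hΦ

lemma height_neg {h : V →ₗ[ℝ] ℝ} (hh : ∀ γ ∈ D.Δ, h γ = 1) {α : V} (hα : α ∈ D.Neg) :
    h α < 0 := by
  have := height_pos hh hα
  rw [map_neg] at this
  linarith

lemma not_neg_of_pos {α : V} (hα : α ∈ D.Pos) : α ∉ D.Neg := by
  obtain ⟨h, hh⟩ := D.exists_height
  exact fun hn => (height_pos hh hα).not_gt (height_neg hh hn)

lemma simple_pos {γ : V} (hγ : γ ∈ D.Δ) : γ ∈ D.Pos :=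
  ⟨D.Δ_sub hγ, fun δ => if δ = γ then 1 else 0, by simp [hγ]⟩

/-- A simple reflection makes only one positive root negative. -/
lemma eq_of_pos_of_sref_neg {β γ : V} (hγ : γ ∈ D.Δ) (hβ : β ∈ D.Pos)
    (hn : sref V γ β ∈ D.Neg) : β = γ := by
  obtain ⟨hΦ, c, hc⟩ := hβ
  obtain ⟨-, d, hd⟩ := hn
  set n : ℝ := 2 * ⟪β, γ⟫ / ⟪γ, γ⟫
  have hsum : ∑ δ ∈ D.Δ, ((c δ : ℝ) + d δ) • δ = ∑ δ ∈ D.Δ, (if δ = γ then n else 0) • δ := by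
    simp only [add_smul, Finset.sum_add_distrib, ite_smul, zero_smul, Finset.sum_ite_eq', hγ,
      if_true]
    rw [← hc, ← hd, sref_apply]
    abel
  have hzero : ∀ δ ∈ D.Δ, δ ≠ γ → c δ = 0 := by
    intro δ hδ hne
    have h0 := D.sum_smul_injOn hsum δ hδ
    rw [if_neg hne] at h0
    have : c δ + d δ = 0 := by exact_mod_cast h0
    omega
  have hβγ : β = (c γ : ℝ) • γ := by
    rw [hc]
    exact Finset.sum_eq_single_of_mem γ hγ fun δ hδ hne => by simp [hzero δ hδ hne]
  rcases D.reduced γ (D.Δ_sub hγ) (c γ) (hβγ ▸ hΦ) with h1 | h1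
  · rw [hβγ, h1, one_smul]
  · have : (0 : ℝ) ≤ c γ := Nat.cast_nonneg _
    linarith

lemma prod_sref_mem {l : List V} (hl : ∀ γ ∈ l, γ ∈ D.Δ) {β : V} (hβ : β ∈ D.Φ) :
    (l.map (sref V)).prod β ∈ D.Φ := by
  induction l with
  | nil => simpa using hβ
  | cons γ t ih =>
    rw [List.forall_mem_cons] at hl
    exact D.reflClosed γ (D.Δ_sub hl.1) _ (ih hl.2)

/-- The exchange condition. -/
lemma exists_shorter_word {l : List V} (hl : ∀ γ ∈ l, γ ∈ D.Δ) {α : V} (hα : α ∈ D.Δ)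
    (hn : (l.map (sref V)).prod α ∈ D.Neg) :
    ∃ l' : List V, l'.length < l.length ∧ (∀ γ ∈ l', γ ∈ D.Δ) ∧
      (l'.map (sref V)).prod = (l.map (sref V)).prod * sref V α := by
  induction l with
  | nil => exact absurd (by simpa using hn) (not_neg_of_pos (simple_pos hα))
  | cons γ t ih =>
    rw [List.forall_mem_cons] at hl
    rcases pos_or_neg (prod_sref_mem hl.2 (D.Δ_sub hα)) with hp | hn'
    · refine ⟨t, by simp, hl.2, ?_⟩
      have hγ := eq_of_pos_of_sref_neg hl.1 hp hn
      rw [List.map_cons, List.prod_cons, mul_assoc, prod_sref_mul_sref, hγ, ← mul_assoc,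
        sref_mul_self, one_mul]
    · obtain ⟨l', hlen, hmem, hprod⟩ := ih hl.2 hn'
      exact ⟨γ :: l', by simpa using hlen, List.forall_mem_cons.mpr ⟨hl.1, hmem⟩,
        by simp [hprod, mul_assoc]⟩

lemma prod_sref_mem_W {l : List V} (hl : ∀ γ ∈ l, γ ∈ D.Δ) : (l.map (sref V)).prod ∈ D.W := by
  refine Subgroup.list_prod_mem _ fun x hx => ?_
  obtain ⟨γ, hγ, rfl⟩ := List.mem_map.mp hx
  exact Subgroup.subset_closure ⟨γ, hl γ hγ, rfl⟩

lemma exists_word {w : V ≃ₗ[ℝ] V} (hw : w ∈ D.W) :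
    ∃ l : List V, (∀ γ ∈ l, γ ∈ D.Δ) ∧ w = (l.map (sref V)).prod := by
  induction hw using Subgroup.closure_induction with
  | mem x hx =>
    obtain ⟨γ, hγ, rfl⟩ := hx
    exact ⟨[γ], by simpa using hγ, by simp⟩
  | one => exact ⟨[], by simp, by simp⟩
  | mul x y _ _ hx hy =>
    obtain ⟨l, hl, rfl⟩ := hx
    obtain ⟨l', hl', rfl⟩ := hy
    exact ⟨l ++ l', fun γ hγ => (List.mem_append.mp hγ).elim (hl γ) (hl' γ), by simp⟩
  | inv x _ hx =>
    obtain ⟨l, hl, rfl⟩ := hx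
    exact ⟨l.reverse, by simpa using hl, inv_prod_sref l⟩

lemma exists_reduced_word {w : V ≃ₗ[ℝ] V} (hw : w ∈ D.W) :
    ∃ l : List V, l.length = D.length w ∧ (∀ γ ∈ l, γ ∈ D.Δ) ∧ w = (l.map (sref V)).prod := by
  obtain ⟨l, hl, hwl⟩ := exists_word hw
  exact Nat.sInf_mem (s := {n | ∃ l : List V, l.length = n ∧ (∀ γ ∈ l, γ ∈ D.Δ) ∧
    w = (l.map (sref V)).prod}) ⟨_, l, rfl, hl, hwl⟩

lemma length_prod_le {l : List V} (hl : ∀ γ ∈ l, γ ∈ D.Δ) :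
    D.length (l.map (sref V)).prod ≤ l.length :=
  Nat.sInf_le ⟨l, rfl, hl, rfl⟩

end RSD

namespace MRSD

variable {V : Type} [NormedAddCommGroup V] [InnerProductSpace ℝ V] (M : MRSD V)

/-- A word in the simple roots of minimal length among all words representing elements of its
coset modulo `W_P`. -/
def IsMinWord (l : List V) : Prop :=
  (∀ γ ∈ l, γ ∈ M.Δ) ∧ ∀ l' : List V, (∀ γ ∈ l', γ ∈ M.Δ) →
    ((l.map (sref V)).prod)⁻¹ * (l'.map (sref V)).prod ∈ M.WP → l.length ≤ l'.length

variable {M}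

lemma IsMinWord.tail {γ : V} {t : List V} (h : M.IsMinWord (γ :: t)) : M.IsMinWord t := by
  obtain ⟨hΔ, hmin⟩ := h
  rw [List.forall_mem_cons] at hΔ
  refine ⟨hΔ.2, fun l' hl' hP => ?_⟩
  have := hmin (γ :: l') (List.forall_mem_cons.mpr ⟨hΔ.1, hl'⟩) (by
    simpa [mul_assoc] using hP)
  simpa using this

lemma IsMinWord.pos {l : List V} (h : M.IsMinWord l) {α : V} (hα : α ∈ M.Δ) (hne : α ≠ M.αP) :
    (l.map (sref V)).prod α ∈ M.Pos := by
  refine (RSD.pos_or_neg (RSD.prod_sref_mem h.1 (M.Δ_sub hα))).resolve_right fun hn => ?_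
  obtain ⟨l', hlen, hl', hprod⟩ := RSD.exists_shorter_word h.1 hα hn
  refine (h.2 l' hl' ?_).not_gt hlen
  rw [hprod, inv_mul_cancel_left]
  exact Subgroup.subset_closure ⟨α, by simp [hα, hne], rfl⟩

lemma inner_sum_simple {ω : V} (hω : ∀ γ ∈ M.Δ, ⟪ω, γ⟫ = if γ = M.αP then (1 : ℝ) else 0)
    (c : V → ℕ) : ⟪ω, ∑ γ ∈ M.Δ, (c γ : ℝ) • γ⟫ = (c M.αP : ℝ) := by
  rw [inner_sum, Finset.sum_eq_single_of_mem M.αP M.αP_mem]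
  · simp [real_inner_smul_right, hω _ M.αP_mem]
  · intro γ hγ hne
    simp [real_inner_smul_right, hω γ hγ, hne]

lemma coeff_le_one {ω : V} (hω : ∀ γ ∈ M.Δ, ⟪ω, γ⟫ = if γ = M.αP then (1 : ℝ) else 0)
    {α : V} (hα : α ∈ M.Φ) : ⟪ω, α⟫ ≤ (1 : ℝ) := by
  obtain ⟨d, hd⟩ := M.θ_high α hα
  obtain ⟨e, he, he1⟩ := M.θ_coeff
  have h1 := inner_sum_simple hω d
  have h2 := inner_sum_simple hω e
  rw [← hd, inner_sub_right] at h1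
  rw [← he, he1] at h2
  have : (0 : ℝ) ≤ d M.αP := Nat.cast_nonneg _
  push_cast at h2
  linarith

/-- A word minimal modulo `W_P` makes no positive root of `Φ_P` negative. -/
lemma IsMinWord.not_neg {l : List V} (h : M.IsMinWord l) {β : V} {c : V → ℕ}
    (hβ : β = ∑ γ ∈ M.Δ, (c γ : ℝ) • γ) (hc : c M.αP = 0) :
    (l.map (sref V)).prod β ∉ M.Neg := by
  intro hn
  obtain ⟨f, hf⟩ := M.exists_height
  refine (RSD.height_neg hf hn).not_ge ?_
  rw [hβ, map_sum, map_sum]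
  refine Finset.sum_nonneg fun γ hγ => ?_
  rw [map_smul, map_smul, smul_eq_mul]
  by_cases hγP : γ = M.αP
  · simp [hγP, hc]
  · exact mul_nonneg (Nat.cast_nonneg _) (RSD.height_pos hf (h.pos hγ hγP)).le

lemma IsMinWord.inner_eq_one {ω : V}
    (hω : ∀ γ ∈ M.Δ, ⟪ω, γ⟫ = if γ = M.αP then (1 : ℝ) else 0) {γ : V} {t : List V}
    (h : M.IsMinWord (γ :: t)) : ⟪(t.map (sref V)).prod ω, γ⟫ = (1 : ℝ) := by
  have hγ : γ ∈ M.Δ := h.1 γ (by simp)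
  have hrev : ∀ δ ∈ t.reverse, δ ∈ M.Δ := by simpa using h.tail.1
  rw [inner_prod_sref]
  set β := ((t.map (sref V)).prod)⁻¹ γ with hβ
  have htβ : (t.map (sref V)).prod β = γ := by
    rw [hβ, ← LinearEquiv.mul_apply, mul_inv_cancel, LinearEquiv.coe_one, id]
  have hnegγ : -γ ∈ M.Neg := by
    simpa [RSD.Neg] using RSD.simple_pos hγ
  have hβΦ : β ∈ M.Φ := by
    rw [hβ, inv_prod_sref]
    exact RSD.prod_sref_mem hrev (M.Δ_sub hγ)
  have hβpos : β ∈ M.Pos := by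
    refine (RSD.pos_or_neg hβΦ).resolve_right fun hn => ?_
    rw [hβ, inv_prod_sref] at hn
    obtain ⟨l', hlen, hl', hprod⟩ := RSD.exists_shorter_word hrev hγ hn
    have hle := h.2 l'.reverse (by simpa using hl') (by
      rw [← inv_prod_sref, hprod, ← inv_prod_sref]
      simp only [List.map_cons, List.prod_cons, mul_inv_rev, sref_inv, inv_inv]
      rw [mul_assoc, ← mul_assoc (sref V γ), sref_mul_self, one_mul, inv_mul_cancel]
      exact one_mem _)
    simp only [List.length_cons, List.length_reverse] at hle hlen
    omega
  obtain ⟨-, c, hc⟩ := hβpos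
  have hval := inner_sum_simple hω c
  rw [← hc] at hval
  have hle := coeff_le_one hω hβΦ
  rw [hval] at hle ⊢
  have hc1 : c M.αP ≤ 1 := by exact_mod_cast hle
  have hc0 : c M.αP ≠ 0 := fun h0 => h.not_neg hc h0 <| by
    rwa [List.map_cons, List.prod_cons, LinearEquiv.mul_apply, htβ, sref_self]
  have : c M.αP = 1 := by omega
  exact_mod_cast this

lemma IsMinWord.exists_coeff {ω : V}
    (hω : ∀ γ ∈ M.Δ, ⟪ω, γ⟫ = if γ = M.αP then (1 : ℝ) else 0) {l : List V}
    (h : M.IsMinWord l) :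
    ∃ c : V → ℤ, (ω - (l.map (sref V)).prod ω = ∑ γ ∈ M.Δ, (c γ : ℝ) • coroot γ) ∧
      (l.length : ℤ) = ∑ γ ∈ M.Δ, c γ := by
  induction l with
  | nil => exact ⟨0, by simp, by simp⟩
  | cons γ t ih =>
    obtain ⟨c, hc, hlen⟩ := ih h.tail
    have hγ : γ ∈ M.Δ := h.1 γ (by simp)
    refine ⟨fun δ => c δ + if δ = γ then 1 else 0, ?_, ?_⟩
    · rw [List.map_cons, List.prod_cons, LinearEquiv.mul_apply, sref_apply_coroot,
        h.inner_eq_one hω, one_smul, sub_sub_eq_add_sub, add_sub_right_comm, hc]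
      simp [add_smul, Finset.sum_add_distrib, hγ]
    · simp [Finset.sum_add_distrib, hγ, hlen]

end MRSD

/-- Let `w ∈ W^P`.  Then `ℓ(w) = height(ω_P^∨ - w ω_P^∨)`, i.e. the length
of `w` equals the sum of the coefficients of `ω_P^∨ - w(ω_P^∨)` written in the basis of
simple coroots.  Here `ω` is the fundamental coweight associated with `α_P`, characterized by
`⟪ω, γ⟫ = δ_{γ, α_P}` for all simple roots `γ`. -/
theorem statement1 {V : Type} [NormedAddCommGroup V] [InnerProductSpace ℝ V]
    [FiniteDimensional ℝ V]
    (M : MRSD V) (w : V ≃ₗ[ℝ] V) (hw : M.IsMinRep w)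
    (ω : V) (hω : ∀ γ ∈ M.Δ, ⟪ω, γ⟫ = if γ = M.αP then (1 : ℝ) else 0) :
    ∃ c : V → ℤ, (ω - w ω = ∑ γ ∈ M.Δ, (c γ : ℝ) • coroot γ) ∧
      (M.length w : ℤ) = ∑ γ ∈ M.Δ, c γ := by
  obtain ⟨l, hlen, hl, hwl⟩ := RSD.exists_reduced_word hw.1
  rw [← hlen, hwl]
  refine MRSD.IsMinWord.exists_coeff hω ⟨hl, fun l' hl' hP => ?_⟩
  rw [hlen]
  exact (hw.2 _ (RSD.prod_sref_mem_W hl') (hwl ▸ hP)).trans (RSD.length_prod_le hl')
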